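/- In a category with translation endofunctors $(T_c)_{c\ge 0}$ and natural transformations $\tau_c : \mathrm{Id} \Rightarrow T_c$ as above, the interleaving distance $d(F,G) := \inf\{a+b : (F,G) \text{ is } (a,b)\text{-interleaved}\}$ satisfies the triangle inequality: $d(F,H) \le d(F,G) + d(G,H)$ for any objects $F, G, H$ (with the convention $\inf \emptyset = \infty$). -/

import Mathlib

open scoped ENNReal NNReal

open CategoryTheory

/-- A category equipped with a family of translation endofunctors `(T c)` indexed by
`c ∈ ℝ≥0`, with `T 0 = Id`, `T c ∘ T c' = T (c + c')`, and natural transformations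
`τ c : Id ⟹ T c` satisfying `τ 0 = id` and `T c (τ c') ∘ τ c = τ (c + c')`. -/
structure TranslationSystem (C : Type*) [Category C] where
  T : NNReal → C ⥤ C
  T_zero : T 0 = 𝟭 C
  T_add : ∀ c c' : NNReal, T c' ⋙ T c = T (c + c')
  τ : ∀ c : NNReal, 𝟭 C ⟶ T c
  τ_zero : τ 0 = eqToHom T_zero.symm
  τ_comp : ∀ (c c' : NNReal) (F : C),
    (τ c).app F ≫ (T c).map ((τ c').app F) ≫ eqToHom (Functor.congr_obj (T_add c c') F)
      = (τ (c + c')).app F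

/-- The pair `(F, G)` is `(a,b)`-interleaved. -/
def Interleaved {C : Type*} [Category C] (S : TranslationSystem C) (a b : NNReal)
    (F G : C) : Prop :=
  ∃ (α δ : F ⟶ (S.T a).obj G) (β γ : G ⟶ (S.T b).obj F),
    α ≫ (S.T a).map β ≫ eqToHom (Functor.congr_obj (S.T_add a b) F)
        = (S.τ (a + b)).app F
    ∧ γ ≫ (S.T b).map δ ≫
          eqToHom (show (S.T a ⋙ S.T b).obj G = (S.T (a + b)).obj G by
            rw [S.T_add b a, add_comm])
        = (S.τ (a + b)).app G

/-- The interleaving distance `d(F, G) = inf { a + b : (F,G) is (a,b)-interleaved }`,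
with the convention `inf ∅ = ∞`. -/
noncomputable def interleavingDist {C : Type*} [Category C] (S : TranslationSystem C)
    (F G : C) : ℝ≥0∞ :=
  sInf {x : ℝ≥0∞ | ∃ a b : NNReal, Interleaved S a b F G ∧ x = (a : ℝ≥0∞) + b}

namespace TranslationSystem

variable {C : Type*} [Category C] (S : TranslationSystem C)

lemma map_add (c c' : NNReal) {X Y : C} (f : X ⟶ Y) :
    (S.T (c + c')).map f =
      eqToHom (Functor.congr_obj (S.T_add c c').symm X) ≫ (S.T c).map ((S.T c').map f) ≫
        eqToHom (Functor.congr_obj (S.T_add c c') Y) :=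
  Functor.congr_hom (S.T_add c c').symm f

lemma τ_app_comp_map_τ_app (c c' : NNReal) (X : C) :
    (S.τ c).app X ≫ (S.T c).map ((S.τ c').app X) =
      (S.τ (c + c')).app X ≫ eqToHom (Functor.congr_obj (S.T_add c c').symm X) := by
  simp [← S.τ_comp c c' X]

lemma τ_app_congr {c c' : NNReal} (h : c = c') (X : C) :
    (S.τ c).app X = (S.τ c').app X ≫ eqToHom (by rw [h]) := by
  subst h
  simp

/-- Shifting `τ_c` at `T_b X` by `T_a` after `τ_{a+b}` gives `τ_{a+(c+b)}`. -/
lemma τ_app_comp_map_τ_app_obj (a b c : NNReal) (X : C) :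
    (S.τ a).app X ≫ (S.T a).map ((S.τ b).app X) ≫ (S.T a).map ((S.τ c).app ((S.T b).obj X)) =
      (S.τ (a + (c + b))).app X ≫
        eqToHom (by rw [← S.T_add a (c + b), ← S.T_add c b]; rfl) := by
  have nat := (S.τ c).naturality ((S.τ b).app X)
  simp only [Functor.id_map, Functor.id_obj] at nat
  rw [← Functor.map_comp, nat, S.τ_app_comp_map_τ_app, Functor.map_comp, ← Category.assoc,
    S.τ_app_comp_map_τ_app]
  simp [eqToHom_map]

/-- One of the two triangles of an interleaving: `X ⟶ T_a Y` and `Y ⟶ T_b X` compose to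
`τ_{a+b}` at `X`. -/
def HalfInterleaved (a b : NNReal) (X Y : C) : Prop :=
  ∃ (f : X ⟶ (S.T a).obj Y) (g : Y ⟶ (S.T b).obj X),
    f ≫ (S.T a).map g =
      (S.τ (a + b)).app X ≫ eqToHom (Functor.congr_obj (S.T_add a b).symm X)

variable {S}

lemma interleaved_iff {a b : NNReal} {X Y : C} :
    Interleaved S a b X Y ↔ S.HalfInterleaved a b X Y ∧ S.HalfInterleaved b a Y X := by
  constructor
  · rintro ⟨f, f', g, g', h, h'⟩
    refine ⟨⟨f, g, ?_⟩, ⟨g', f', ?_⟩⟩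
    · simp [← h]
    · rw [S.τ_app_congr (add_comm b a), ← h']
      simp
  · rintro ⟨⟨f, g, h⟩, ⟨g', f', h'⟩⟩
    refine ⟨f, f', g, g', ?_, ?_⟩
    · rw [reassoc_of% h]
      simp
    · rw [reassoc_of% h', S.τ_app_congr (add_comm b a)]
      simp

lemma HalfInterleaved.trans {a b a' b' : NNReal} {X Y Z : C}
    (h : S.HalfInterleaved a b X Y) (h' : S.HalfInterleaved a' b' Y Z) :
    S.HalfInterleaved (a + a') (b + b') X Z := by
  obtain ⟨f, g, h⟩ := h
  obtain ⟨f', g', h'⟩ := h'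
  have e : (S.T b').obj ((S.T b).obj X) = (S.T (b + b')).obj X := by
    rw [add_comm, ← S.T_add]; rfl
  refine ⟨f ≫ (S.T a).map f' ≫ eqToHom (Functor.congr_obj (S.T_add a a') Z),
    g' ≫ (S.T b').map g ≫ eqToHom e, ?_⟩
  have middle : f' ≫ (S.T a').map g' ≫ (S.T a').map ((S.T b').map g) =
      g ≫ (S.τ (a' + b')).app ((S.T b).obj X) ≫
        eqToHom (Functor.congr_obj (S.T_add a' b').symm _) := by
    have nat := (S.τ (a' + b')).naturality g
    simp only [Functor.id_map, Functor.id_obj] at nat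
    rw [reassoc_of% h', reassoc_of% nat, S.map_add]
    simp
  have outer : f ≫ (S.T a).map g =
      (S.τ a).app X ≫ (S.T a).map ((S.τ b).app X) := by
    rw [h, S.τ_app_comp_map_τ_app]
  have total := congrArg (fun k => f ≫ (S.T a).map k) middle
  simp only [Functor.map_comp, reassoc_of% outer, eqToHom_map] at total
  rw [reassoc_of% (S.τ_app_comp_map_τ_app_obj a b (a' + b') X)] at total
  have hc : a + a' + (b + b') = a + (a' + b' + b) := by ring
  rw [S.τ_app_congr hc, S.map_add]
  simp only [Functor.map_comp, Category.assoc, eqToHom_trans_assoc, eqToHom_refl,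
    Category.id_comp, eqToHom_map, eqToHom_trans]
  rw [reassoc_of% total]
  simp

lemma _root_.Interleaved.trans {a b a' b' : NNReal} {X Y Z : C}
    (h : Interleaved S a b X Y) (h' : Interleaved S a' b' Y Z) :
    Interleaved S (a + a') (b + b') X Z := by
  rw [interleaved_iff] at *
  refine ⟨h.1.trans h'.1, ?_⟩
  rw [add_comm a, add_comm b]
  exact h'.2.trans h.2

end TranslationSystem

/-- The interleaving distance satisfies the triangle inequality. -/
theorem stmt_9 {C : Type*} [Category C] (S : TranslationSystem C) (F G H : C) :
    interleavingDist S F H ≤ interleavingDist S F G + interleavingDist S G H := by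
  unfold interleavingDist
  rw [ENNReal.sInf_add]
  refine le_iInf₂ fun x hx => ?_
  rw [ENNReal.add_sInf]
  refine le_iInf₂ fun y hy => sInf_le ?_
  obtain ⟨a, b, h, rfl⟩ := hx
  obtain ⟨a', b', h', rfl⟩ := hy
  exact ⟨a + a', b + b', h.trans h', by push_cast; ring⟩
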